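/- Let x be a harmonic bounded operator on F and let I and J = [j₁, …, j_m] be words with J nonempty. Then the sequence (P_ω^n(x r_I (r_J)*)) converges in SOT to x r_I (r_J)* + ∑_{t=1}^{m} ω_{(J^op)_t} • ( (l_{(J^op)_t})* x r_I p_Ω (r_{J_{m−t}})* ), where (J^op)_t = [j_m, j_{m−1}, …, j_{m−t+1}] and J_{m−t} = [j₁, …, j_{m−t}]. In particular, for i, j ∈ Θ and harmonic x, the SOT limit of P_ω^n(x r_i (r_j)*) equals x r_i (r_j)* + ω j • ((l_j)* x r_i p_Ω). -/

import Mathlib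

open Filter Topology

noncomputable section

/-- The full Fock space over a Hilbert space with orthonormal basis indexed by `Θ`,
realized as `ℓ²(List Θ)`. -/
abbrev Fock (Θ : Type*) : Type _ := lp (fun _ : List Θ => ℂ) 2

/-- The canonical orthonormal basis vector `e_I` of the Fock space, indexed by a word
`I : List Θ`.  The vacuum vector is `Ω = fockBasis []`. -/
noncomputable def fockBasis {Θ : Type*} [DecidableEq Θ] (I : List Θ) : Fock Θ :=
  lp.single 2 I 1

/-- For a word `I = [i₁, …, i_k]`, `wordOp r I = r i₁ ∘L ⋯ ∘L r i_k`, the identity for the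
empty word.  Applied to the right (resp. left) creation operators, this gives `r_I`
(resp. `l_I`). -/
noncomputable def wordOp {Θ : Type*} (r : Θ → Fock Θ →L[ℂ] Fock Θ) :
    List Θ → (Fock Θ →L[ℂ] Fock Θ)
  | [] => 1
  | i :: I => r i ∘L wordOp r I

section helpers
variable {Θ : Type*} [DecidableEq Θ]

open ContinuousLinearMap (adjoint)

theorem fock_inner_basis (I : List Θ) (v : Fock Θ) :
    (inner ℂ (fockBasis I) v : ℂ) = v I := by
  unfold fockBasis
  rw [lp.inner_single_left]
  simp

theorem fockBasis_apply (I K : List Θ) :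
    (fockBasis I : Fock Θ) K = if K = I then 1 else 0 := by
  unfold fockBasis
  by_cases h : K = I
  · subst h; simp
  · rw [lp.single_apply_ne _ _ _ h]; simp [h]

theorem fock_ext {A B : Fock Θ →L[ℂ] Fock Θ}
    (h : ∀ I, A (fockBasis I) = B (fockBasis I)) : A = B := by
  ext1 v
  have hv : HasSum (fun I => (v I) • (fockBasis I : Fock Θ)) v := by
    have := lp.hasSum_single (p := 2) (by simp) v
    refine this.congr_fun ?_ 
    intro I
    unfold fockBasis
    rw [← lp.single_smul]
    simp
  have hA := hv.mapL A
  have hB := hv.mapL B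
  simp only [map_smul, h] at hA hB
  exact hA.unique hB

theorem fock_adj_basis_apply (A : Fock Θ →L[ℂ] Fock Θ) (v : Fock Θ) (K : List Θ) :
    (adjoint A v) K = inner ℂ (A (fockBasis K)) v := by
  rw [← fock_inner_basis, ContinuousLinearMap.adjoint_inner_right]

section
variable (l r : Θ → Fock Θ →L[ℂ] Fock Θ)
    (hl : ∀ (i : Θ) (I : List Θ), l i (fockBasis I) = fockBasis (i :: I))
    (hr : ∀ (i : Θ) (I : List Θ), r i (fockBasis I) = fockBasis (I ++ [i]))
    (pΩ : Fock Θ →L[ℂ] Fock Θ)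
    (hpΩ : ∀ v : Fock Θ,
      pΩ v = (inner ℂ (fockBasis ([] : List Θ)) v : ℂ) • fockBasis ([] : List Θ))

include hl in
theorem l_norm (i : Θ) (v : Fock Θ) : ‖l i v‖ = ‖v‖ := by
  have h : adjoint (l i) ∘L l i = 1 := by
    apply fock_ext
    intro I
    ext K
    simp only [ContinuousLinearMap.comp_apply, fock_adj_basis_apply, hl, fock_inner_basis,
      one_apply_eq_self, fockBasis_apply]
    simp
  exact (ContinuousLinearMap.norm_map_iff_adjoint_comp_self (l i)).2 h v

include hr in
theorem radj_nil (j : Θ) : adjoint (r j) (fockBasis []) = 0 := by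
  ext K
  simp [fock_adj_basis_apply, hr, fock_inner_basis, fockBasis_apply]

include hr in
theorem radj_append (j k : Θ) (K : List Θ) :
    adjoint (r j) (fockBasis (K ++ [k])) = if j = k then fockBasis K else 0 := by
  ext L
  rw [fock_adj_basis_apply, hr, fock_inner_basis, fockBasis_apply]
  by_cases h : j = k
  · simp [h, fockBasis_apply]
  · simp [h]

include hpΩ in
theorem pΩ_basis (K : List Θ) : pΩ (fockBasis K) = if K = [] then fockBasis [] else 0 := by
  rw [hpΩ, fock_inner_basis, fockBasis_apply]
  by_cases h : K = []
  · simp [h]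
  · simp [h, Ne.symm h]

include hl hr hpΩ in
theorem radj_l (i j : Θ) :
    adjoint (r j) ∘L l i = l i ∘L adjoint (r j) + (if i = j then pΩ else 0) := by
  apply fock_ext
  intro K
  rcases List.eq_nil_or_concat K with rfl | ⟨K', k, rfl⟩
  · have := radj_append r hr j i []
    simp only [List.nil_append] at this
    simp only [ContinuousLinearMap.comp_apply, add_apply, hl, this,
      radj_nil r hr]
    by_cases h : i = j
    · simp [h, pΩ_basis pΩ hpΩ]
    · simp [h, Ne.symm h]
  · have h1 := radj_append r hr j k (i :: K')
    have h2 := radj_append r hr j k K'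
    rw [List.cons_append] at h1
    simp only [List.concat_eq_append, ContinuousLinearMap.comp_apply,
      add_apply, hl, h1, h2]
    have h3 : (if i = j then pΩ else 0) (fockBasis (K' ++ [k])) = 0 := by
      split_ifs
      · simp [pΩ_basis pΩ hpΩ]
      · simp
    rw [h3]
    split_ifs <;> simp [hl]

omit [DecidableEq Θ] in
theorem wordOp_append (J : List Θ) (j : Θ) :
    wordOp r (J ++ [j]) = wordOp r J ∘L r j := by
  induction J with
  | nil => simp only [List.nil_append, wordOp]; rfl
  | cons k J ih => simp only [List.cons_append, wordOp, ih]; rfl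

omit [DecidableEq Θ] in
theorem adj_wordOp_append (J : List Θ) (j : Θ) :
    adjoint (wordOp r (J ++ [j])) = adjoint (r j) ∘L adjoint (wordOp r J) := by
  rw [wordOp_append, ContinuousLinearMap.adjoint_comp]

omit [DecidableEq Θ] in
theorem adj_wordOp_nil : adjoint (wordOp r []) = 1 := by
  simp only [wordOp]
  exact ContinuousLinearMap.adjoint_id

include hl hr in
theorem wordOp_l_comm (I : List Θ) (i : Θ) (v : Fock Θ) :
    wordOp r I (l i v) = l i (wordOp r I v) := by
  induction I with
  | nil => simp [wordOp]
  | cons k I ih =>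
    have : r k ∘L l i = l i ∘L r k := by
      apply fock_ext
      intro K
      simp [hl, hr]
    simp only [wordOp, ContinuousLinearMap.comp_apply, ih]
    exact congrArg (fun A => A (wordOp r I v)) this

include hr hpΩ in
theorem radj_pΩ (j : Θ) (v : Fock Θ) : adjoint (r j) (pΩ v) = 0 := by
  rw [hpΩ, map_smul, radj_nil r hr, smul_zero]

include hl hpΩ in
theorem pΩ_l (i : Θ) (v : Fock Θ) : pΩ (l i v) = 0 := by
  have : pΩ ∘L l i = 0 := by
    apply fock_ext
    intro K
    simp [hl, pΩ_basis pΩ hpΩ]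
  exact congrArg (fun A => A v) this

include hl hr hpΩ in
theorem radj_l_apply (i j : Θ) (v : Fock Θ) :
    adjoint (r j) (l i v) = l i (adjoint (r j) v) + (if i = j then pΩ v else 0) := by
  have := congrArg (fun A => A v) (radj_l l r hl hr pΩ hpΩ i j)
  simp only [ContinuousLinearMap.comp_apply, add_apply] at this
  rw [this]
  split_ifs <;> simp

include hl hr hpΩ in
theorem radj_word_aux (J : List Θ) (i : Θ) : ∀ (j : Θ) (v : Fock Θ),
    adjoint (r j) (adjoint (wordOp r J) (l i v)) =
      adjoint (r j) (l i (adjoint (wordOp r J) v)) := by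
  induction J using List.reverseRecOn with
  | nil => intro j v; simp [adj_wordOp_nil]
  | append_singleton J k ih =>
    intro j v
    simp only [adj_wordOp_append, ContinuousLinearMap.comp_apply, ih]
    rw [radj_l_apply l r hl hr pΩ hpΩ i k, map_add]
    split_ifs <;> simp [radj_pΩ r hr pΩ hpΩ]

include hl hr hpΩ in
theorem radj_word (J : List Θ) (i j : Θ) (v : Fock Θ) :
    adjoint (wordOp r (J ++ [j])) (l i v) =
      l i (adjoint (wordOp r (J ++ [j])) v)
        + (if i = j then pΩ (adjoint (wordOp r J) v) else 0) := by
  simp only [adj_wordOp_append, ContinuousLinearMap.comp_apply]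
  rw [radj_word_aux l r hl hr pΩ hpΩ, radj_l_apply l r hl hr pΩ hpΩ]

variable (ω : Θ → ℝ) (hω : ∀ i, 0 < ω i) (hω1 : ∑' i, ω i = 1)
    (P : (Fock Θ →L[ℂ] Fock Θ) → (Fock Θ →L[ℂ] Fock Θ))
    (hP : ∀ (x : Fock Θ →L[ℂ] Fock Θ) (v : Fock Θ),
      P x v = ∑' i, (ω i : ℂ) • ((adjoint (l i) ∘L x ∘L l i) v))

include hl hω hω1 in
theorem P_summable (x : Fock Θ →L[ℂ] Fock Θ) (v : Fock Θ) :
    Summable (fun i => (ω i : ℂ) • ((adjoint (l i) ∘L x ∘L l i) v)) := by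
  have hs : Summable ω := by
    by_contra h
    rw [tsum_eq_zero_of_not_summable h] at hω1
    exact zero_ne_one hω1
  have hn : ∀ i, ‖adjoint (l i)‖ ≤ 1 := by
    intro i
    rw [LinearIsometryEquiv.norm_map]
    refine ContinuousLinearMap.opNorm_le_bound _ zero_le_one ?_
    intro w
    rw [l_norm l hl, one_mul]
  refine Summable.of_norm_bounded (hs.mul_right (‖x‖ * ‖v‖)) ?_
  intro i
  rw [norm_smul, Complex.norm_real, Real.norm_of_nonneg (hω i).le]
  refine mul_le_mul_of_nonneg_left ?_ (hω i).le
  calc ‖adjoint (l i) (x (l i v))‖ ≤ 1 * ‖x (l i v)‖ :=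
        (adjoint (l i)).le_of_opNorm_le (hn i) _
    _ = ‖x (l i v)‖ := one_mul _
    _ ≤ ‖x‖ * ‖l i v‖ := x.le_opNorm _
    _ = ‖x‖ * ‖v‖ := by rw [l_norm l hl]

include hl hω hω1 hP in
theorem P_add (x y : Fock Θ →L[ℂ] Fock Θ) : P (x + y) = P x + P y := by
  ext1 v
  rw [add_apply, hP, hP, hP,
    ← (P_summable l hl ω hω hω1 x v).tsum_add (P_summable l hl ω hω hω1 y v)]
  congr 1
  ext1 i
  simp

include hl hr hpΩ hP in
theorem P_vac_append (y : Fock Θ →L[ℂ] Fock Θ) (K : List Θ) (k : Θ) :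
    P (y ∘L pΩ ∘L adjoint (wordOp r (K ++ [k]))) =
      (ω k : ℂ) • (adjoint (l k) ∘L y ∘L pΩ ∘L adjoint (wordOp r K)) := by
  have hpp : ∀ v, pΩ (pΩ v) = pΩ v := by
    intro v
    rw [hpΩ v, map_smul, pΩ_basis pΩ hpΩ]
    simp
  ext1 v
  rw [hP, tsum_eq_single k]
  · simp [-Complex.coe_smul, radj_word l r hl hr pΩ hpΩ, pΩ_l l hl pΩ hpΩ, hpp]
  · intro i hi
    simp [radj_word l r hl hr pΩ hpΩ, pΩ_l l hl pΩ hpΩ, hi]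

include hl hpΩ hP in
theorem P_vac_nil (y : Fock Θ →L[ℂ] Fock Θ) :
    P (y ∘L pΩ ∘L adjoint (wordOp r [])) = 0 := by
  ext1 v
  rw [hP]
  simp [adj_wordOp_nil, pΩ_l l hl pΩ hpΩ]

include hl hr hpΩ hω hω1 hP in
theorem P_main (x : Fock Θ →L[ℂ] Fock Θ) (hx : P x = x) (I K : List Θ) (k : Θ) :
    P (x ∘L wordOp r I ∘L adjoint (wordOp r (K ++ [k]))) =
      x ∘L wordOp r I ∘L adjoint (wordOp r (K ++ [k])) +
        P ((x ∘L wordOp r I) ∘L pΩ ∘L adjoint (wordOp r (K ++ [k]))) := by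
  rw [P_vac_append l r hl hr pΩ hpΩ ω P hP]
  ext1 v
  set w := wordOp r I (adjoint (wordOp r (K ++ [k])) v) with hw
  have h1 : x w = ∑' i, (ω i : ℂ) • ((adjoint (l i) ∘L x ∘L l i) w) := by
    rw [← hP, hx]
  rw [add_apply]
  have h2 : (x ∘L wordOp r I ∘L adjoint (wordOp r (K ++ [k]))) v = x w := rfl
  rw [h2, h1, hP]
  have h3 := (hasSum_ite_eq k ((ω k : ℂ) •
    (adjoint (l k) ∘L (x ∘L wordOp r I) ∘L pΩ ∘L adjoint (wordOp r K)) v))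
  rw [smul_apply, ← h3.tsum_eq,
    ← (P_summable l hl ω hω hω1 x w).tsum_add h3.summable]
  congr 1
  ext1 i
  simp only [ContinuousLinearMap.comp_apply, radj_word l r hl hr pΩ hpΩ, map_add,
    wordOp_l_comm l r hl hr, smul_add, ← hw]
  congr 1
  by_cases h : i = k
  · subst h; simp
  · simp [h]

/-- The correction term. -/
def corr (z : Fock Θ →L[ℂ] Fock Θ) (J : List Θ) (t : ℕ) : Fock Θ →L[ℂ] Fock Θ :=
  (((((J.reverse).take t).map ω).prod : ℝ) : ℂ) •
    (adjoint (wordOp l ((J.reverse).take t)) ∘L z ∘L pΩ ∘L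
      adjoint (wordOp r (J.take (J.length - t))))

omit [DecidableEq Θ] in
theorem corr_eq (z : Fock Θ →L[ℂ] Fock Θ) (J : List Θ) (t : ℕ) :
    corr l r pΩ ω z J t = ((((((J.reverse).take t).map ω).prod : ℝ) : ℂ) •
      (adjoint (wordOp l ((J.reverse).take t)) ∘L z)) ∘L pΩ ∘L
      adjoint (wordOp r (J.take (J.length - t))) := rfl

include hl hr hpΩ hP in
theorem P_corr (z : Fock Θ →L[ℂ] Fock Θ) (J : List Θ) (t : ℕ) (ht : t < J.length) :
    P (corr l r pΩ ω z J t) = corr l r pΩ ω z J (t + 1) := by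
  have hlt : J.length - (t + 1) < J.length := by omega
  have e1 : J.take (J.length - t) = J.take (J.length - (t + 1)) ++ [J[J.length - (t + 1)]] := by
    rw [← List.take_succ_eq_append_getElem hlt]
    congr 1
    omega
  have e2 : J.reverse.take (t + 1) = J.reverse.take t ++ [J[J.length - (t + 1)]] := by
    rw [List.take_succ_eq_append_getElem (by simpa using ht), List.getElem_reverse]
    congr 3
    omega
  rw [corr_eq, e1, P_vac_append l r hl hr pΩ hpΩ ω P hP]
  unfold corr
  rw [e2, adj_wordOp_append]
  ext1 v
  simp [-Complex.coe_smul, smul_smul, mul_comm]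

include hl hpΩ hP in
theorem P_corr_last (z : Fock Θ →L[ℂ] Fock Θ) (J : List Θ) :
    P (corr l r pΩ ω z J J.length) = 0 := by
  rw [corr_eq, Nat.sub_self, List.take_zero, P_vac_nil l r hl pΩ hpΩ ω P hP]

include hl hr hpΩ hω hω1 hP in
theorem P_iter (x : Fock Θ →L[ℂ] Fock Θ) (hx : P x = x) (I J : List Θ) (hJ : J ≠ []) (n : ℕ) :
    P^[n] (x ∘L wordOp r I ∘L adjoint (wordOp r J)) =
      x ∘L wordOp r I ∘L adjoint (wordOp r J) +
        ∑ t ∈ Finset.Icc 1 (min n J.length), corr l r pΩ ω (x ∘L wordOp r I) J t := by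
  set z := x ∘L wordOp r I with hz
  have h0 : P 0 = 0 := by
    have := P_add l hl ω hω hω1 P hP 0 0
    simpa using this
  let Ph : (Fock Θ →L[ℂ] Fock Θ) →+ (Fock Θ →L[ℂ] Fock Θ) :=
    { toFun := P, map_zero' := h0, map_add' := P_add l hl ω hω hω1 P hP }
  have hsum : ∀ s : Finset ℕ, P (∑ t ∈ s, corr l r pΩ ω z J t) =
      ∑ t ∈ s, P (corr l r pΩ ω z J t) := fun s => map_sum Ph _ s
  have hpos : 0 < J.length := List.length_pos_iff.2 hJ
  have hX : P (x ∘L wordOp r I ∘L adjoint (wordOp r J)) =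
      x ∘L wordOp r I ∘L adjoint (wordOp r J) + corr l r pΩ ω z J 1 := by
    have hc0 : corr l r pΩ ω z J 0 = z ∘L pΩ ∘L adjoint (wordOp r J) := by
      rw [corr_eq]
      simp only [List.take_zero, adj_wordOp_nil, Nat.sub_zero, List.take_length]
      simp [ContinuousLinearMap.one_def]
    have h1 : P (corr l r pΩ ω z J 0) = corr l r pΩ ω z J 1 :=
      P_corr l r hl hr pΩ hpΩ ω P hP z J 0 hpos
    rw [← h1, hc0, hz]
    rcases List.eq_nil_or_concat J with rfl | ⟨K, k, rfl⟩
    · exact absurd rfl hJ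
    · rw [List.concat_eq_append]
      exact P_main l r hl hr pΩ hpΩ ω hω hω1 P hP x hx I K k
  have hIcc : ∀ m : ℕ, m ≤ J.length →
      ∑ t ∈ Finset.Icc 1 m, corr l r pΩ ω z J t =
        ∑ t ∈ Finset.range m, corr l r pΩ ω z J (t + 1) := by
    intro m _
    rw [Finset.range_eq_Ico, Finset.sum_Ico_add' (fun t => corr l r pΩ ω z J t) 0 m 1]
    rfl
  rw [hIcc _ (min_le_right _ _)]
  induction n with
  | zero => simp
  | succ n ih =>
    rw [Function.iterate_succ_apply', ih, P_add l hl ω hω hω1 P hP, hX, add_assoc]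
    congr 1
    rw [← hIcc _ (min_le_right _ _), hsum]
    rcases lt_or_ge n J.length with h | h
    · rw [min_eq_left h.le, min_eq_left (by omega : n + 1 ≤ J.length),
        Finset.sum_range_succ', add_comm]
      congr 1
      rw [Finset.range_eq_Ico,
        Finset.sum_Ico_add' (fun t => corr l r pΩ ω z J (t + 1)) 0 n 1]
      refine Finset.sum_congr rfl fun t ht => ?_
      have := Finset.mem_Ico.1 ht
      exact P_corr l r hl hr pΩ hpΩ ω P hP z J t (by omega)
    · rw [min_eq_right h, min_eq_right (by omega : J.length ≤ n + 1)]
      obtain ⟨m, hm⟩ : ∃ m, J.length = m + 1 := ⟨J.length - 1, by omega⟩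
      have hlast := P_corr_last l r hl pΩ hpΩ ω P hP z J
      rw [hm] at hlast ⊢
      rw [Finset.sum_Icc_succ_top (by omega), hlast, add_zero, Finset.sum_range_succ', add_comm]
      congr 1
      rw [Finset.range_eq_Ico,
        Finset.sum_Ico_add' (fun t => corr l r pΩ ω z J (t + 1)) 0 m 1]
      refine Finset.sum_congr rfl fun t ht => ?_
      have := Finset.mem_Ico.1 ht
      exact P_corr l r hl hr pΩ hpΩ ω P hP z J t (by omega)

end
end helpers

/-- For harmonic `x`, a word `I` and a nonempty word `J` of length `m`, the
sequence `(P_ω^n (x r_I (r_J)*))` converges in SOT to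
`x r_I (r_J)* + ∑_{t=1}^{m} ω_{(J^op)_t} • ((l_{(J^op)_t})* x r_I p_Ω (r_{J_{m−t}})*)`.
In particular for letters `i, j` the limit is `x rᵢ (rⱼ)* + ω j • ((lⱼ)* x rᵢ p_Ω)`. -/
theorem statement7 {Θ : Type*} [Countable Θ] [Nonempty Θ] [DecidableEq Θ]
    (l r : Θ → Fock Θ →L[ℂ] Fock Θ)
    (hl : ∀ (i : Θ) (I : List Θ), l i (fockBasis I) = fockBasis (i :: I))
    (hr : ∀ (i : Θ) (I : List Θ), r i (fockBasis I) = fockBasis (I ++ [i]))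
    (pΩ : Fock Θ →L[ℂ] Fock Θ)
    (hpΩ : ∀ v : Fock Θ,
      pΩ v = (inner ℂ (fockBasis ([] : List Θ)) v : ℂ) • fockBasis ([] : List Θ))
    (ω : Θ → ℝ) (hω : ∀ i, 0 < ω i) (hω1 : ∑' i, ω i = 1)
    (P : (Fock Θ →L[ℂ] Fock Θ) → (Fock Θ →L[ℂ] Fock Θ))
    (hP : ∀ (x : Fock Θ →L[ℂ] Fock Θ) (v : Fock Θ),
      P x v = ∑' i, (ω i : ℂ) • ((ContinuousLinearMap.adjoint (l i) ∘L x ∘L l i) v)) :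
    (∀ (x : Fock Θ →L[ℂ] Fock Θ), P x = x → ∀ (I J : List Θ), J ≠ [] →
      ∀ v : Fock Θ,
        Tendsto
          (fun n : ℕ =>
            (P^[n] (x ∘L wordOp r I ∘L ContinuousLinearMap.adjoint (wordOp r J))) v) atTop
          (𝓝 ((x ∘L wordOp r I ∘L ContinuousLinearMap.adjoint (wordOp r J)
            + ∑ t ∈ Finset.Icc 1 J.length,
                (((((J.reverse).take t).map ω).prod : ℝ) : ℂ) •
                  (ContinuousLinearMap.adjoint (wordOp l ((J.reverse).take t)) ∘L x ∘L
                    wordOp r I ∘L pΩ ∘L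
                      ContinuousLinearMap.adjoint (wordOp r (J.take (J.length - t))))) v))) ∧
    (∀ (x : Fock Θ →L[ℂ] Fock Θ), P x = x → ∀ (i j : Θ), ∀ v : Fock Θ,
      Tendsto
        (fun n : ℕ => (P^[n] (x ∘L r i ∘L ContinuousLinearMap.adjoint (r j))) v) atTop
        (𝓝 ((x ∘L r i ∘L ContinuousLinearMap.adjoint (r j)
          + (ω j : ℂ) •
              (ContinuousLinearMap.adjoint (l j) ∘L x ∘L r i ∘L pΩ)) v))) := by
  have main : ∀ (x : Fock Θ →L[ℂ] Fock Θ), P x = x → ∀ (I J : List Θ), J ≠ [] →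
      ∀ v : Fock Θ,
        Tendsto
          (fun n : ℕ =>
            (P^[n] (x ∘L wordOp r I ∘L ContinuousLinearMap.adjoint (wordOp r J))) v) atTop
          (𝓝 ((x ∘L wordOp r I ∘L ContinuousLinearMap.adjoint (wordOp r J)
            + ∑ t ∈ Finset.Icc 1 J.length, corr l r pΩ ω (x ∘L wordOp r I) J t) v)) := by
    intro x hx I J hJ v
    refine tendsto_const_nhds.congr' ?_
    filter_upwards [eventually_ge_atTop J.length] with n hn
    rw [P_iter l r hl hr pΩ hpΩ ω hω hω1 P hP x hx I J hJ n, min_eq_right hn]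
  refine ⟨main, ?_⟩
  intro x hx i j v
  have h := main x hx [i] [j] (by simp) v
  have e : ∀ (a : Θ → Fock Θ →L[ℂ] Fock Θ) (k : Θ), wordOp a [k] = a k := fun a k => rfl
  have hc : corr l r pΩ ω (x ∘L r i) [j] 1 =
      (ω j : ℂ) • (ContinuousLinearMap.adjoint (l j) ∘L x ∘L r i ∘L pΩ) := by
    unfold corr
    ext1 w
    simp [-Complex.coe_smul, e, adj_wordOp_nil]
  simpa only [e, List.length_singleton, Finset.Icc_self, Finset.sum_singleton, hc] using h
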